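/- arXiv:2103.13695 — 2 statements merged into one kernel-verified Lean document; each statement's English description precedes it below -/
import Mathlib

section
/- Let n ≥ 0. For each x ∈ Z(G), ν^n_{G,x,α} maps CS^n(G, k x̄) into CS^n(k_αG,k_αG) and induces a k-linear map ν^{n,S}_{G,x,α} : HS^n(G, k x̄) → HHS^n(k_αG); likewise π^n_{G,x,α} maps CS^n(k_αG,k_αG) into CS^n(G, k x̄) and induces π^{n,S}_{G,x,α} : HHS^n(k_αG) → HS^n(G, k x̄). Moreover the map ⊕_{x∈Z(G)} ν^{n,S}_{G,x,α} : ⊕_{x∈Z(G)} HS^n(G, k x̄) → HHS^n(k_αG) is injective and admits ⊕_{x∈Z(G)} π^{n,S}_{G,x,α} : HHS^n(k_αG) → ⊕_{x∈Z(G)} HS^n(G, k x̄) as a left inverse (which is therefore surjective). -/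
/- Common setup: twisted group algebras modelled on their canonical basis.
An element of the twisted group algebra `k_αG` is modelled as a function `G → k`
(its coordinates in the basis `{ḡ : g ∈ G}`), and a Hochschild `n`-cochain
`Hom_k((k_αG)^{⊗n}, M)` is modelled by its values on basis tensors, i.e. as a
function `(Fin n → G) → M`.  Similarly a group cochain `C^n(H, A)` is a function
`(Fin n → H) → A`; the one-dimensional module `k x̄` is modelled as `k` with the
action of `h` given by multiplication by the character `χ(h) = α(h,x)·α(x,h)⁻¹`. -/

namespace TwistedSym

section Defs

variable {k : Type*} [CommRing k] {G : Type*} [Group G] [DecidableEq G]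
variable {M : Type*} [AddCommGroup M] [Module k M]
variable {H : Type*} [Group H]
variable {A : Type*} [AddCommGroup A] [DistribMulAction H A]

/-- The 2-cocycle condition `α(x,yz)α(y,z) = α(xy,z)α(x,y)`. -/
def IsCocycle (α : G → G → kˣ) : Prop :=
  ∀ x y z : G, α x (y * z) * α y z = α (x * y) z * α x y

/-- Normalization `α(1,x) = α(x,1) = 1`. -/
def IsNormalized (α : G → G → kˣ) : Prop :=
  ∀ x : G, α 1 x = 1 ∧ α x 1 = 1

/-- `(L, R)` encode a `(k_αG, k_αG)`-bimodule structure on the `k`-module `M`: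
`L g` is left multiplication by the basis element `ḡ` and `R g` is right
multiplication by `ḡ`. -/
def IsBimodule (α : G → G → kˣ) (L R : G → M →ₗ[k] M) : Prop :=
  (∀ m : M, L 1 m = m) ∧ (∀ m : M, R 1 m = m) ∧
  (∀ (g h : G) (m : M), L g (L h m) = (α g h : k) • L (g * h) m) ∧
  (∀ (g h : G) (m : M), R h (R g m) = (α g h : k) • R (g * h) m) ∧
  (∀ (g h : G) (m : M), L g (R h m) = R h (L g m))

/-- The tuple of group elements appearing in the action of the transposition
`σ_{i0+1} = (i0+1, i0+2)` on `n`-cochains (0-indexed `i0 : Fin n`):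
position `i0 - 1` gets `g_{i0-1}·g_{i0}`, position `i0` gets `g_{i0}⁻¹` and
position `i0 + 1` gets `g_{i0}·g_{i0+1}` (when these positions exist). -/
def swapTuple {n : ℕ} (i0 : Fin n) (g : Fin n → H) : Fin n → H := fun j =>
  if (j : ℕ) + 1 = (i0 : ℕ) then g j * g i0
  else if j = i0 then (g i0)⁻¹
  else if (j : ℕ) = (i0 : ℕ) + 1 then g i0 * g j
  else g j

/-- The action of the transposition `σ_{i0+1} = (i0+1,i0+2) ∈ Σ_{n+1}` on Hochschild
`n`-cochains of the twisted group algebra `k_αG` with coefficients in the bimodule `M`.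
All the `α`-scalars come from rewriting products and inverses of basis elements in
terms of basis elements: `ḡ·h̄ = α(g,h)·(gh)‾` and `ḡ⁻¹ = α(g,g⁻¹)⁻¹·(g⁻¹)‾`. -/
def hSigma (α : G → G → kˣ) (L R : G → M →ₗ[k] M) {n : ℕ} (i0 : Fin n)
    (φ : (Fin n → G) → M) : (Fin n → G) → M := fun g =>
  -(((if 0 < (i0 : ℕ) then
        (α (g ⟨(i0 : ℕ) - 1, lt_of_le_of_lt (Nat.sub_le _ _) i0.isLt⟩) (g i0) : k) else 1) *
     (((α (g i0) (g i0)⁻¹)⁻¹ : kˣ) : k) *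
     (if h : (i0 : ℕ) + 1 < n then (α (g i0) (g ⟨(i0 : ℕ) + 1, h⟩) : k) else 1)) •
    (if (i0 : ℕ) = 0 then
        L (g i0) (if (i0 : ℕ) + 1 = n then R (g i0) (φ (swapTuple i0 g)) else φ (swapTuple i0 g))
      else (if (i0 : ℕ) + 1 = n then R (g i0) (φ (swapTuple i0 g)) else φ (swapTuple i0 g))))

/-- Staic's action of the transposition `σ_{i0+1} ∈ Σ_{n+1}` on group `n`-cochains
with values in an `H`-module `A`. -/
def gSigma {n : ℕ} (i0 : Fin n) (ψ : (Fin n → H) → A) : (Fin n → H) → A := fun h =>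
  -(if (i0 : ℕ) = 0 then h i0 • ψ (swapTuple i0 h) else ψ (swapTuple i0 h))

/-- Staic's action of the transposition `σ_{i0+1} ∈ Σ_{n+1}` on group `n`-cochains
with values in the rank-one module `k` on which `H` acts through the character `χ`. -/
def cSigma (χ : H → k) {n : ℕ} (i0 : Fin n) (ψ : (Fin n → H) → k) : (Fin n → H) → k := fun h =>
  -(if (i0 : ℕ) = 0 then χ (h i0) * ψ (swapTuple i0 h) else ψ (swapTuple i0 h))

/-- The `(n+1)`-tuple `g` with entries at positions `j, j+1` multiplied together. -/
def mergeAt {n : ℕ} (g : Fin (n + 1) → H) (j : Fin n) : Fin n → H := fun l =>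
  if (l : ℕ) < (j : ℕ) then g (Fin.castSucc l)
  else if l = j then g (Fin.castSucc l) * g (Fin.succ l)
  else g (Fin.succ l)

/-- The Hochschild differential `δ^n` for the twisted group algebra `k_αG` with
coefficients in the bimodule `M`, written on basis tensors (the scalar
`α(g_j, g_{j+1})` comes from `ḡ_j·ḡ_{j+1} = α(g_j,g_{j+1})·(g_jg_{j+1})‾`). -/
def hDiff (α : G → G → kˣ) (L R : G → M →ₗ[k] M) {n : ℕ}
    (φ : (Fin n → G) → M) : (Fin (n + 1) → G) → M := fun g =>
  L (g 0) (φ fun j => g j.succ)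
    + ∑ j : Fin n, ((-1 : ℤ) ^ ((j : ℕ) + 1)) •
        ((α (g j.castSucc) (g j.succ) : k) • φ (mergeAt g j))
    + ((-1 : ℤ) ^ (n + 1)) • R (g (Fin.last n)) (φ fun j => g j.castSucc)

/-- The group cohomology differential `∂^n` for cochains on `H` with values in the
`H`-module `A`. -/
def gDiff {n : ℕ} (ψ : (Fin n → H) → A) : (Fin (n + 1) → H) → A := fun h =>
  h 0 • ψ (fun j => h j.succ)
    + ∑ j : Fin n, ((-1 : ℤ) ^ ((j : ℕ) + 1)) • ψ (mergeAt h j)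
    + ((-1 : ℤ) ^ (n + 1)) • ψ (fun j => h j.castSucc)

/-- The group cohomology differential `∂^n` for cochains on `H` with values in the
rank-one module `k` on which `H` acts through the character `χ`. -/
def cDiff (χ : H → k) {n : ℕ} (ψ : (Fin n → H) → k) : (Fin (n + 1) → H) → k := fun h =>
  χ (h 0) * ψ (fun j => h j.succ)
    + ∑ j : Fin n, ((-1 : ℤ) ^ ((j : ℕ) + 1)) • ψ (mergeAt h j)
    + ((-1 : ℤ) ^ (n + 1)) • ψ (fun j => h j.castSucc)

/-- Left multiplication by the basis element `ḡ` on `k_αG` (modelled as `G → k`). -/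
def Lmul (α : G → G → kˣ) (g : G) : (G → k) →ₗ[k] (G → k) where
  toFun a := fun y => (α g (g⁻¹ * y) : k) * a (g⁻¹ * y)
  map_add' a b := by funext y; simp [mul_add]
  map_smul' c a := by funext y; simp [smul_eq_mul]; ring

/-- Right multiplication by the basis element `ḡ` on `k_αG` (modelled as `G → k`). -/
def Rmul (α : G → G → kˣ) (g : G) : (G → k) →ₗ[k] (G → k) where
  toFun a := fun y => (α (y * g⁻¹) g : k) * a (y * g⁻¹)
  map_add' a b := by funext y; simp [mul_add]
  map_smul' c a := by funext y; simp [smul_eq_mul]; ring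

/-- Iterated right multiplication: `rmuls α [g₁,…,gₙ] v = v·ḡ₁·…·ḡₙ`. -/
def rmuls (α : G → G → kˣ) (l : List G) (v : G → k) : G → k :=
  l.foldl (fun w g => Rmul α g w) v

/-- Iterated right multiplication by inverses of basis elements:
`rinvs α [h₁,…,hₙ] v = v·h̄ₙ⁻¹·…·h̄₁⁻¹`, using `h̄⁻¹ = α(h,h⁻¹)⁻¹·(h⁻¹)‾`. -/
def rinvs (α : G → G → kˣ) (l : List G) (v : G → k) : G → k :=
  l.foldr (fun h w => (((α h h⁻¹)⁻¹ : kˣ) : k) • Rmul α h⁻¹ w) v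

/-- The character through which `h ∈ C_G(x)` acts on the module `k x̄`:
`χ(h) = α(h,x)·α(x,h)⁻¹`. -/
def chi (α : G → G → kˣ) (x : G) : G → k := fun h =>
  (α h x : k) * (((α x h)⁻¹ : kˣ) : k)

/-- The map `π^n_{G,x,α} : C^n(k_αG, k_αG) → C^n(C_G(x), k x̄)`: the value on
`(h₁,…,hₙ)` is the coefficient of the basis element `x̄` in
`φ(h̄₁⊗…⊗h̄ₙ)·h̄ₙ⁻¹·…·h̄₁⁻¹` (identifying `k x̄` with `k`). -/
def piC (α : G → G → kˣ) (x : G) {n : ℕ} (φ : (Fin n → G) → (G → k)) :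
    (Fin n → Subgroup.centralizer ({x} : Set G)) → k := fun h =>
  rinvs α (List.ofFn fun i => (h i : G)) (φ fun i => (h i : G)) x

/-- The same map as `piC` for a central element `x`, in which case `C_G(x) = G`:
`π^n_{G,x,α} : C^n(k_αG, k_αG) → C^n(G, k x̄)`. -/
def piZ (α : G → G → kˣ) (x : G) {n : ℕ} (φ : (Fin n → G) → (G → k)) :
    (Fin n → G) → k := fun h =>
  rinvs α (List.ofFn h) (φ h) x

/-- The map `ν^n_{G,x,α} : C^n(G, k x̄) → C^n(k_αG, k_αG)` for `x ∈ Z(G)`: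
`ψ ↦ (ḡ₁⊗…⊗ḡₙ ↦ ψ(g₁,…,gₙ)·x̄·ḡ₁·…·ḡₙ)` (identifying `k x̄` with `k`). -/
def nuZ (α : G → G → kˣ) (x : G) {n : ℕ} (ψ : (Fin n → G) → k) :
    (Fin n → G) → (G → k) := fun g =>
  ψ g • rmuls α (List.ofFn g) (Pi.single x 1)

/-- Iteration of the index map of a coset decomposition along a list of group
elements: `chainIdx idx j [g₁,…,gᵢ]` is the index `s_j^i`. -/
def chainIdx {m : ℕ} (idx : Fin m → G → Fin m) (j : Fin m) : List G → Fin m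
  | [] => j
  | a :: l => chainIdx idx (idx j a) l

/-- The map `ν^n_{G,x} : C^n(C_G(x), kx) → C^n(kG, kG)` for the (untwisted) group
algebra, relative to a right coset decomposition `G = ⋃ⱼ C_G(x)γⱼ`:
`ν(ψ)(g₁⊗…⊗gₙ) = Σⱼ ψ(h_{j,1},…,h_{j,n})·x⁻¹·xⱼ·g₁⋯gₙ` where
`xⱼ = γⱼ⁻¹xγⱼ`, the `h_{j,i} = rep (s_j^{i-1}) gᵢ ∈ C_G(x)` are determined by
`γ_{s_j^{i-1}}·gᵢ = h_{j,i}·γ_{s_j^i}` and `kx` is identified with `k`. -/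
def nuT (x : G) {m n : ℕ} (γ : Fin m → G) (idx : Fin m → G → Fin m)
    (rep : Fin m → G → G)
    (hrep : ∀ j a, rep j a ∈ Subgroup.centralizer ({x} : Set G))
    (ψ : (Fin n → Subgroup.centralizer ({x} : Set G)) → k) :
    (Fin n → G) → (G → k) := fun g =>
  ∑ j : Fin m,
    ψ (fun i => ⟨rep (chainIdx idx j ((List.ofFn g).take (i : ℕ))) (g i), hrep _ _⟩) •
      (Pi.single ((γ j)⁻¹ * x * γ j * (List.ofFn g).prod) (1 : k) : G → k)

/-- `φ` is a Hochschild coboundary (for `n = 0` the coboundary space is `0`). -/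
def IsHCoboundary (α : G → G → kˣ) (L R : G → M →ₗ[k] M) :
    ∀ {n : ℕ}, ((Fin n → G) → M) → Prop
  | 0, φ => φ = 0
  | _ + 1, φ => ∃ θ, φ = hDiff α L R θ

/-- `φ` is the Hochschild coboundary of a `Σ`-invariant cochain. -/
def IsHSCoboundary (α : G → G → kˣ) (L R : G → M →ₗ[k] M) :
    ∀ {n : ℕ}, ((Fin n → G) → M) → Prop
  | 0, φ => φ = 0
  | _ + 1, φ => ∃ θ, (∀ i0, hSigma α L R i0 θ = θ) ∧ φ = hDiff α L R θ

/-- `ψ` is a group-cohomology coboundary (coefficients in `k` through `χ`). -/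
def IsCCoboundary (χ : H → k) : ∀ {n : ℕ}, ((Fin n → H) → k) → Prop
  | 0, ψ => ψ = 0
  | _ + 1, ψ => ∃ θ, ψ = cDiff χ θ

/-- `ψ` is the coboundary of a `Σ`-invariant group cochain (coefficients through `χ`). -/
def IsCSCoboundary (χ : H → k) : ∀ {n : ℕ}, ((Fin n → H) → k) → Prop
  | 0, ψ => ψ = 0
  | _ + 1, ψ => ∃ θ, (∀ i0, cSigma χ i0 θ = θ) ∧ ψ = cDiff χ θ

/-- `ψ` is a group-cohomology coboundary (coefficients in the `H`-module `A`). -/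
def IsGCoboundary : ∀ {n : ℕ}, ((Fin n → H) → A) → Prop
  | 0, ψ => ψ = 0
  | _ + 1, ψ => ∃ θ, ψ = gDiff θ

/-- `ψ` is the coboundary of a `Σ`-invariant group cochain (coefficients in `A`). -/
def IsGSCoboundary : ∀ {n : ℕ}, ((Fin n → H) → A) → Prop
  | 0, ψ => ψ = 0
  | _ + 1, ψ => ∃ θ, (∀ i0, gSigma i0 θ = θ) ∧ ψ = gDiff θ

end Defs

section Coordinates

variable {k : Type*} [CommRing k] {G : Type*} [Group G]

/-- The scalar by which the product `ḡ₁·…·ḡₙ` differs from the basis element of `g₁⋯gₙ`. -/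
def weight (α : G → G → kˣ) : List G → kˣ
  | [] => 1
  | a :: l => α a l.prod * weight α l

/-- The coefficient of `v` along `z̄·ḡ₁·…·ḡₙ`, for `l = [g₁,…,gₙ]`. -/
def coef (α : G → G → kˣ) (z : G) (l : List G) (v : G → k) : k :=
  (((weight α (z :: l))⁻¹ : kˣ) : k) * v (z * l.prod)

/-- The scalar relating `ḡ·z'‾` to `z̄·ḡ`, where `z' = g⁻¹zg`. -/
def conjScalar (α : G → G → kˣ) (z g : G) : kˣ :=
  α g (g⁻¹ * z * g) * (α z g)⁻¹

variable {α : G → G → kˣ}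

theorem weight_merge (hα : IsCocycle α) (A : List G) (a b : G) (B : List G) :
    weight α (A ++ a :: b :: B) = α a b * weight α (A ++ (a * b) :: B) := by
  induction A with
  | nil =>
    have h := hα a b B.prod
    simp only [List.nil_append, weight, List.prod_cons]
    rw [← mul_assoc, h]
    simp only [mul_assoc, mul_comm]
  | cons c A ih =>
    simp only [List.cons_append, weight, ih, List.prod_append, List.prod_cons, mul_assoc,
      mul_left_comm]

theorem weight_insert_one (hnorm : IsNormalized α) (A B : List G) :
    weight α (A ++ 1 :: B) = weight α (A ++ B) := by
  induction A with
  | nil => simp [weight, (hnorm _).1]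
  | cons c A ih => simp [weight, ih]

theorem coef_nil (hnorm : IsNormalized α) (z : G) (v : G → k) : coef α z [] v = v z := by
  simp [coef, weight, (hnorm z).2]

theorem coef_merge (hα : IsCocycle α) (z : G) (A : List G) (a b : G) (B : List G) (v : G → k) :
    coef α z (A ++ (a * b) :: B) v = (α a b : k) * coef α z (A ++ a :: b :: B) v := by
  simp only [coef, ← List.cons_append, weight_merge hα (z :: A) a b B]
  simp [mul_assoc, mul_left_comm]

theorem coef_insert_inv (hα : IsCocycle α) (hnorm : IsNormalized α) (z : G) (A : List G) (a : G)
    (B : List G) (v : G → k) :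
    coef α z (A ++ B) v = (α a a⁻¹ : k) * coef α z (A ++ a :: a⁻¹ :: B) v := by
  rw [← coef_merge hα, mul_inv_cancel]
  simp only [coef, ← List.cons_append, weight_insert_one hnorm]
  simp

theorem coef_smul (z : G) (l : List G) (c : k) (v : G → k) :
    coef α z l (c • v) = c * coef α z l v := by
  simp [coef, mul_left_comm]

theorem weight_concat (hα : IsCocycle α) (hnorm : IsNormalized α) (A : List G) (a : G) :
    weight α (A ++ [a]) = weight α A * α A.prod a := by
  induction A with
  | nil => simp [weight, (hnorm _).1, (hnorm _).2]
  | cons c A ih =>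
    have h := hα c A.prod a
    simp only [List.cons_append, weight, ih, List.prod_append, List.prod_cons, List.prod_nil,
      mul_one]
    rw [mul_comm (weight α A), ← mul_assoc, h]
    simp only [mul_assoc, mul_comm, mul_left_comm]

theorem coef_concat_Rmul (hα : IsCocycle α) (hnorm : IsNormalized α) (z : G) (l : List G) (a : G)
    (v : G → k) : coef α z (l ++ [a]) (Rmul α a v) = coef α z l v := by
  simp only [coef, ← List.cons_append, weight_concat hα hnorm]
  simp [Rmul, mul_assoc, mul_left_comm]

theorem coef_cons_Lmul (hα : IsCocycle α) (z a : G) (l : List G) (v : G → k) :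
    coef α z (a :: l) (Lmul α a v) = (conjScalar α z a : k) * coef α (a⁻¹ * z * a) l v := by
  have key : (weight α (z :: a :: l))⁻¹ * α a (a⁻¹ * z * a * l.prod) =
      conjScalar α z a * (weight α ((a⁻¹ * z * a) :: l))⁻¹ := by
    have h₁ := hα a (a⁻¹ * z * a) l.prod
    have h₂ := hα z a l.prod
    have h₃ : a * (a⁻¹ * z * a) = z * a := by group
    rw [h₃] at h₁
    simp only [weight, conjScalar, List.prod_cons]
    rw [inv_mul_eq_div, ← div_eq_mul_inv, ← div_eq_mul_inv, div_div, div_eq_div_iff_mul_eq_mul]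
    calc _ = α a (a⁻¹ * z * a * l.prod) * α (a⁻¹ * z * a) l.prod * (α z a * weight α l) := by
          simp only [mul_assoc, mul_left_comm]
      _ = α a (a⁻¹ * z * a) * (α z (a * l.prod) * α a l.prod * weight α l) := by
          rw [h₁, h₂]
          simp only [mul_assoc, mul_left_comm]
      _ = _ := by simp only [mul_assoc]
  have key' := congrArg (Units.val) key
  simp only [Units.val_mul] at key'
  simp only [coef, ← mul_assoc, ← key']
  simp only [Lmul, LinearMap.coe_mk, AddHom.coe_mk, List.prod_cons, ← mul_assoc]

theorem Lmul_Rmul (hα : IsCocycle α) (g h : G) (v : G → k) :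
    Lmul α g (Rmul α h v) = Rmul α h (Lmul α g v) := by
  funext y
  have e := hα g (g⁻¹ * y * h⁻¹) h
  simp only [mul_assoc, inv_mul_cancel, mul_inv_cancel_left, mul_one] at e
  simp only [Lmul, Rmul, LinearMap.coe_mk, AddHom.coe_mk, ← mul_assoc, ← Units.val_mul]
  simp only [mul_assoc, e]

theorem rinvs_apply (hα : IsCocycle α) (hnorm : IsNormalized α) (l : List G) (v : G → k) (z : G) :
    rinvs α l v z = coef α z l v := by
  induction l generalizing z with
  | nil => exact (coef_nil hnorm z v).symm
  | cons a l ih =>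
    have h := hα z a a⁻¹
    rw [mul_inv_cancel, (hnorm z).2, one_mul] at h
    have hz : coef α (z * a) l v = (α z a : k) * coef α z (a :: l) v := by
      have := weight_merge hα [] z a l
      simp only [List.nil_append] at this
      simp [coef, this, mul_assoc, mul_left_comm]
    have hr : rinvs α (a :: l) v = (((α a a⁻¹)⁻¹ : kˣ) : k) • Rmul α a⁻¹ (rinvs α l v) := rfl
    rw [hr]
    simp only [Pi.smul_apply, smul_eq_mul, Rmul, LinearMap.coe_mk, AddHom.coe_mk, inv_inv, ih, hz]
    rw [h]
    simp only [mul_inv_rev, Units.val_mul, mul_assoc]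
    rw [Units.inv_mul_cancel_left, Units.inv_mul_cancel_left]

theorem coef_rmuls (hα : IsCocycle α) (hnorm : IsNormalized α) (l : List G) (v : G → k) (z : G) :
    coef α z l (rmuls α l v) = v z := by
  induction l using List.reverseRecOn with
  | nil => exact coef_nil hnorm z v
  | append_singleton l a ih =>
    have hr : rmuls α (l ++ [a]) v = Rmul α a (rmuls α l v) := by simp [rmuls]
    rw [hr, coef_concat_Rmul hα hnorm, ih]

theorem coef_ext {l : List G} {v v' : G → k} (h : ∀ z, coef α z l v = coef α z l v') :
    v = v' := by
  funext y
  have := h (y * l.prod⁻¹)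
  simpa [coef] using this

end Coordinates

section Tuples

theorem ofFn_eq_take_append_drop {H : Type*} {n : ℕ} (g : Fin (n + 1) → H) (j : Fin n) :
    List.ofFn g = (List.ofFn g).take j ++ g j.castSucc :: g j.succ :: (List.ofFn g).drop (j + 2) := by
  apply List.ext_getElem
  · simp; omega
  · intro i h₁ h₂
    simp only [List.getElem_append, List.getElem_cons, List.getElem_ofFn, List.getElem_take,
      List.getElem_drop, List.length_take, List.length_ofFn]
    split_ifs <;> first | rfl | (congr 1; ext; simp; omega)

variable {H : Type*} [Group H]

theorem ofFn_mergeAt {n : ℕ} (g : Fin (n + 1) → H) (j : Fin n) :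
    List.ofFn (mergeAt g j) =
      (List.ofFn g).take j ++ (g j.castSucc * g j.succ) :: (List.ofFn g).drop (j + 2) := by
  apply List.ext_getElem
  · simp; omega
  · intro i h₁ h₂
    simp only [List.getElem_append, List.getElem_cons, List.getElem_ofFn, List.getElem_take,
      List.getElem_drop, List.length_take, List.length_ofFn, mergeAt, Fin.ext_iff]
    split_ifs <;> first | rfl | omega | (congr 1; ext; simp; omega) | (congr 1 <;> congr 1 <;> (ext; simp; omega))

end Tuples

section Swap

variable {H : Type*} [Group H]

theorem ofFn_swapTuple_single (g : Fin 1 → H) (i : Fin 1) :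
    List.ofFn g = [g i] ∧ List.ofFn (swapTuple i g) = [(g i)⁻¹] := by
  obtain rfl : i = 0 := Subsingleton.elim _ _
  simp [swapTuple]

theorem ofFn_swapTuple_first {n : ℕ} (g : Fin n → H) (i : Fin n) (h₀ : (i : ℕ) = 0)
    (h : (i : ℕ) + 1 < n) :
    List.ofFn g = g i :: g ⟨i + 1, h⟩ :: (List.ofFn g).drop 2 ∧
    List.ofFn (swapTuple i g) =
      (g i)⁻¹ :: (g i * g ⟨i + 1, h⟩) :: (List.ofFn g).drop 2 := by
  constructor <;>
  · apply List.ext_getElem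
    · simp; omega
    · intro j h₁ h₂
      simp only [List.getElem_cons, List.getElem_ofFn, List.getElem_drop, swapTuple, Fin.ext_iff]
      split_ifs <;> first
        | rfl | omega | (congr 1; ext; simp; omega)
        | (congr 2; ext; simp; omega)

theorem ofFn_swapTuple_last {n : ℕ} (g : Fin n → H) (i : Fin n) (h₀ : 0 < (i : ℕ))
    (h : (i : ℕ) + 1 = n) :
    List.ofFn g = (List.ofFn g).take (i - 1) ++ [g ⟨i - 1, by omega⟩, g i] ∧
    List.ofFn (swapTuple i g) =
      (List.ofFn g).take (i - 1) ++ [g ⟨i - 1, by omega⟩ * g i, (g i)⁻¹] := by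
  constructor <;>
  · apply List.ext_getElem
    · simp; omega
    · intro j h₁ h₂
      simp only [List.length_ofFn] at h₁
      simp only [List.getElem_append, List.getElem_cons, List.getElem_ofFn, List.getElem_take,
        List.length_take, List.length_ofFn, swapTuple, Fin.ext_iff]
      split_ifs <;> first
        | rfl | omega | (congr 1; ext; simp; omega)
        | (congr 2; ext; simp; omega)

theorem ofFn_swapTuple_middle {n : ℕ} (g : Fin n → H) (i : Fin n) (h₀ : 0 < (i : ℕ))
    (h : (i : ℕ) + 1 < n) :
    List.ofFn g = (List.ofFn g).take (i - 1) ++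
      g ⟨i - 1, by omega⟩ :: g i :: g ⟨i + 1, h⟩ :: (List.ofFn g).drop (i + 2) ∧
    List.ofFn (swapTuple i g) = (List.ofFn g).take (i - 1) ++
      (g ⟨i - 1, by omega⟩ * g i) :: (g i)⁻¹ :: (g i * g ⟨i + 1, h⟩) ::
        (List.ofFn g).drop (i + 2) := by
  constructor <;>
  · apply List.ext_getElem
    · simp; omega
    · intro j h₁ h₂
      simp only [List.getElem_append, List.getElem_cons, List.getElem_ofFn, List.getElem_take,
        List.getElem_drop, List.length_take, List.length_ofFn, swapTuple, Fin.ext_iff]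
      split_ifs <;> first
        | rfl | omega | (congr 1; ext; simp; omega)
        | (congr 2; ext; simp; omega)

end Swap

section Intertwining

variable {k : Type*} [CommRing k] {G : Type*} [Group G] {α : G → G → kˣ}

theorem piZ_apply (hα : IsCocycle α) (hnorm : IsNormalized α) (z : G) {n : ℕ}
    (φ : (Fin n → G) → (G → k)) (h : Fin n → G) :
    piZ α z φ h = coef α z (List.ofFn h) (φ h) :=
  rinvs_apply hα hnorm _ _ _

theorem piZ_ext (hα : IsCocycle α) (hnorm : IsNormalized α) {n : ℕ}
    {φ φ' : (Fin n → G) → (G → k)} (h : ∀ z, piZ α z φ = piZ α z φ') : φ = φ' := by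
  funext g
  refine coef_ext (α := α) (l := List.ofFn g) fun z => ?_
  rw [← piZ_apply hα hnorm, ← piZ_apply hα hnorm, h]

theorem piZ_sub (hα : IsCocycle α) (hnorm : IsNormalized α) (z : G) {n : ℕ}
    (φ φ' : (Fin n → G) → (G → k)) : piZ α z (φ - φ') = piZ α z φ - piZ α z φ' := by
  funext g
  simp [piZ_apply hα hnorm, coef, mul_sub]

theorem piZ_zero (hα : IsCocycle α) (hnorm : IsNormalized α) (z : G) {n : ℕ} :
    piZ α z (0 : (Fin n → G) → (G → k)) = 0 := by
  funext g
  simp [piZ_apply hα hnorm, coef]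

theorem piZ_sum (hα : IsCocycle α) (hnorm : IsNormalized α) (z : G) {n : ℕ} {ι : Type*}
    (s : Finset ι) (φ : ι → (Fin n → G) → (G → k)) :
    piZ α z (∑ y ∈ s, φ y) = ∑ y ∈ s, piZ α z (φ y) := by
  funext g
  simp [piZ_apply hα hnorm, coef, Finset.mul_sum]

theorem piZ_nuZ [DecidableEq G] (hα : IsCocycle α) (hnorm : IsNormalized α) (x z : G) {n : ℕ}
    (ψ : (Fin n → G) → k) : piZ α z (nuZ α x ψ) = if z = x then ψ else 0 := by
  funext g
  rw [piZ_apply hα hnorm, nuZ, coef_smul, coef_rmuls hα hnorm]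
  by_cases h : z = x <;> simp [h]

theorem piZ_hDiff (hα : IsCocycle α) (hnorm : IsNormalized α) (z : G) {n : ℕ}
    (φ : (Fin n → G) → (G → k)) (g : Fin (n + 1) → G) :
    piZ α z (hDiff α (Lmul α) (Rmul α) φ) g =
      (conjScalar α z (g 0) : k) * piZ α ((g 0)⁻¹ * z * g 0) φ (fun j => g j.succ)
      + ∑ j : Fin n, ((-1 : ℤ) ^ ((j : ℕ) + 1)) • piZ α z φ (mergeAt g j)
      + ((-1 : ℤ) ^ (n + 1)) • piZ α z φ (fun j => g j.castSucc) := by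
  have hadd (l : List G) (v w : G → k) : coef α z l (v + w) = coef α z l v + coef α z l w := by
    simp [coef, mul_add]
  have hzsmul (l : List G) (m : ℤ) (v : G → k) : coef α z l (m • v) = m • coef α z l v := by
    simp [coef, mul_left_comm]
  have hsum (l : List G) (v : Fin n → G → k) :
      coef α z l (∑ j, v j) = ∑ j, coef α z l (v j) := by
    simp [coef, Finset.mul_sum]
  simp only [piZ_apply hα hnorm, hDiff, hadd, hsum, hzsmul, coef_smul]
  congr 2
  · rw [List.ofFn_succ, coef_cons_Lmul hα]
  · refine Finset.sum_congr rfl fun j _ => ?_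
    rw [ofFn_mergeAt, coef_merge hα, ← ofFn_eq_take_append_drop]
  · rw [List.ofFn_succ', List.concat_eq_append, coef_concat_Rmul hα hnorm]

theorem piZ_hSigma (hα : IsCocycle α) (hnorm : IsNormalized α) (z : G) {n : ℕ} (i : Fin n)
    (φ : (Fin n → G) → (G → k)) (g : Fin n → G) :
    piZ α z (hSigma α (Lmul α) (Rmul α) i φ) g =
      -(if (i : ℕ) = 0 then
          (conjScalar α z (g i) : k) * piZ α ((g i)⁻¹ * z * g i) φ (swapTuple i g)
        else piZ α z φ (swapTuple i g)) := by
  have hneg (l : List G) (v : G → k) : coef α z l (-v) = -coef α z l v := by simp [coef]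
  simp only [piZ_apply hα hnorm, hSigma, hneg, coef_smul]
  congr 1
  have insert (z : G) (A B : List G) (b : G) (v : G → k) :
      (((α b b⁻¹)⁻¹ : kˣ) : k) * coef α z (A ++ B) v = coef α z (A ++ b :: b⁻¹ :: B) v := by
    rw [coef_insert_inv hα hnorm z A b B, Units.inv_mul_cancel_left]
  generalize φ (swapTuple i g) = v
  rcases Nat.eq_zero_or_pos (i : ℕ) with h₀ | h₀ <;>
  rcases Nat.lt_or_ge ((i : ℕ) + 1) n with h | h
  · obtain ⟨e, e'⟩ := ofFn_swapTuple_first g i h₀ h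
    generalize (List.ofFn g).drop 2 = B at e e'
    rw [e', e, if_neg (by omega), if_pos h₀, if_neg (by omega), if_pos h₀, dif_pos h,
      ← coef_cons_Lmul hα, one_mul]
    have m := coef_merge hα z [g i, (g i)⁻¹] (g i) (g ⟨i + 1, h⟩) B
      (Lmul α (g i) v)
    simp only [List.cons_append, List.nil_append] at m
    rw [m, mul_comm (Units.val _), mul_assoc]
    exact congrArg _ (insert z [] _ (g i) _)
  · have hn : n = 1 := by omega
    subst hn
    obtain ⟨e, e'⟩ := ofFn_swapTuple_single g i
    rw [e', e, if_neg (by omega), if_pos h₀, if_pos (by omega), if_pos h₀, dif_neg (by omega),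
      ← coef_cons_Lmul hα, one_mul, mul_one,
      ← coef_concat_Rmul hα hnorm z [g i, (g i)⁻¹] (g i), Lmul_Rmul hα]
    exact insert z [] _ (g i) _
  · obtain ⟨e, e'⟩ := ofFn_swapTuple_middle g i h₀ h
    generalize (List.ofFn g).take (i - 1) = A at e e'
    generalize (List.ofFn g).drop (i + 2) = B at e e'
    rw [e', e, if_pos h₀, if_neg (by omega), if_neg (by omega), if_neg (by omega), dif_pos h,
      coef_merge hα, mul_assoc, mul_assoc]
    congr 1
    have m := coef_merge hα z (A ++ [g ⟨i - 1, by omega⟩, g i, (g i)⁻¹]) (g i) (g ⟨i + 1, h⟩) B v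
    have m' := insert z (A ++ [g ⟨i - 1, by omega⟩]) (g i :: g ⟨i + 1, h⟩ :: B) (g i) v
    simp only [List.append_assoc, List.cons_append, List.nil_append] at m m'
    rw [m, ← m', mul_left_comm]
  · obtain ⟨e, e'⟩ := ofFn_swapTuple_last g i h₀ (by omega)
    generalize (List.ofFn g).take (i - 1) = A at e e'
    rw [e', e, if_pos h₀, if_neg (by omega), if_pos (by omega), if_neg (by omega),
      dif_neg (by omega), mul_one, coef_merge hα, mul_assoc]
    congr 1
    rw [← coef_concat_Rmul hα hnorm z (A ++ [g ⟨i - 1, by omega⟩, g i, (g i)⁻¹]) (g i) v]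
    have m := insert z (A ++ [g ⟨i - 1, by omega⟩]) [g i] (g i) (Rmul α (g i) v)
    simpa only [List.append_assoc, List.cons_append, List.nil_append] using m

end Intertwining

section Central

variable {k : Type*} [CommRing k] {G : Type*} [Group G] {α : G → G → kˣ}

theorem conj_of_mem_center {x : G} (hx : x ∈ Subgroup.center G) (g : G) : g⁻¹ * x * g = x := by
  rw [mul_assoc, ← Subgroup.mem_center_iff.mp hx g, inv_mul_cancel_left]

theorem conjScalar_of_mem_center {x : G} (hx : x ∈ Subgroup.center G) (g : G) :
    (conjScalar α x g : k) = chi α x g := by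
  simp [conjScalar, conj_of_mem_center hx, chi]

theorem conj_not_mem_center {z : G} (hz : z ∉ Subgroup.center G) (g : G) :
    g⁻¹ * z * g ∉ Subgroup.center G := fun h => hz <| by
  have := (Subgroup.Normal.conj_mem inferInstance _ h g : g * (g⁻¹ * z * g) * g⁻¹ ∈ _)
  simpa [mul_assoc] using this

theorem piZ_hDiff_of_mem_center (hα : IsCocycle α) (hnorm : IsNormalized α) {x : G}
    (hx : x ∈ Subgroup.center G) {n : ℕ} (φ : (Fin n → G) → (G → k)) :
    piZ α x (hDiff α (Lmul α) (Rmul α) φ) = cDiff (chi α x) (piZ α x φ) := by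
  funext g
  rw [piZ_hDiff hα hnorm, conj_of_mem_center hx, conjScalar_of_mem_center hx]
  rfl

theorem piZ_hSigma_of_mem_center (hα : IsCocycle α) (hnorm : IsNormalized α) {x : G}
    (hx : x ∈ Subgroup.center G) {n : ℕ} (i : Fin n) (φ : (Fin n → G) → (G → k)) :
    piZ α x (hSigma α (Lmul α) (Rmul α) i φ) = cSigma (chi α x) i (piZ α x φ) := by
  funext g
  rw [piZ_hSigma hα hnorm, conj_of_mem_center hx, conjScalar_of_mem_center hx]
  rfl

theorem cDiff_zero {H : Type*} [Group H] (χ : H → k) {n : ℕ} :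
    cDiff χ (0 : (Fin n → H) → k) = 0 := by
  funext g
  simp [cDiff]

theorem cSigma_zero {H : Type*} [Group H] (χ : H → k) {n : ℕ} (i : Fin n) :
    cSigma χ i (0 : (Fin n → H) → k) = 0 := by
  funext g
  simp [cSigma]

/-- The cochain `φ` takes `(g₁,…,gₙ)` into the span of the `z̄·ḡ₁·…·ḡₙ` with `z` central. -/
def IsCentral (α : G → G → kˣ) {n : ℕ} (φ : (Fin n → G) → (G → k)) : Prop :=
  ∀ z ∉ Subgroup.center G, piZ α z φ = 0

theorem IsCentral.hDiff (hα : IsCocycle α) (hnorm : IsNormalized α) {n : ℕ}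
    {φ : (Fin n → G) → (G → k)} (hφ : IsCentral α φ) :
    IsCentral α (hDiff α (Lmul α) (Rmul α) φ) := by
  intro z hz
  funext g
  simp [piZ_hDiff hα hnorm, hφ z hz, hφ _ (conj_not_mem_center hz _)]

theorem IsCentral.hSigma (hα : IsCocycle α) (hnorm : IsNormalized α) {n : ℕ} (i : Fin n)
    {φ : (Fin n → G) → (G → k)} (hφ : IsCentral α φ) :
    IsCentral α (hSigma α (Lmul α) (Rmul α) i φ) := by
  intro z hz
  funext g
  simp [piZ_hSigma hα hnorm, hφ z hz, hφ _ (conj_not_mem_center hz _)]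

theorem IsCentral.ext (hα : IsCocycle α) (hnorm : IsNormalized α) {n : ℕ}
    {φ φ' : (Fin n → G) → (G → k)} (hφ : IsCentral α φ) (hφ' : IsCentral α φ')
    (h : ∀ x ∈ Subgroup.center G, piZ α x φ = piZ α x φ') : φ = φ' :=
  piZ_ext hα hnorm fun z =>
    (Classical.em (z ∈ Subgroup.center G)).elim (h z) fun hz => (hφ z hz).trans (hφ' z hz).symm

theorem IsHSCoboundary.piZ (hα : IsCocycle α) (hnorm : IsNormalized α) {x : G}
    (hx : x ∈ Subgroup.center G) {n : ℕ} {φ : (Fin n → G) → (G → k)}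
    (h : IsHSCoboundary α (Lmul α) (Rmul α) φ) :
    IsCSCoboundary (chi α x) (piZ α x φ) := by
  cases n with
  | zero =>
    obtain rfl : φ = 0 := h
    exact piZ_zero hα hnorm x
  | succ n =>
    obtain ⟨θ, hθ, rfl⟩ := h
    exact ⟨_, fun i => by rw [← piZ_hSigma_of_mem_center hα hnorm hx, hθ],
      piZ_hDiff_of_mem_center hα hnorm hx θ⟩

theorem isCSCoboundary_zero {H : Type*} [Group H] (χ : H → k) {n : ℕ} :
    IsCSCoboundary χ (0 : (Fin n → H) → k) := by
  cases n with
  | zero => rfl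
  | succ n => exact ⟨0, fun i => cSigma_zero χ i, (cDiff_zero χ).symm⟩

variable [DecidableEq G]

theorem isCentral_nuZ (hα : IsCocycle α) (hnorm : IsNormalized α) {x : G}
    (hx : x ∈ Subgroup.center G) {n : ℕ} (ψ : (Fin n → G) → k) : IsCentral α (nuZ α x ψ) := by
  intro z hz
  rw [piZ_nuZ hα hnorm, if_neg (fun h : z = x => hz (h ▸ hx))]

theorem hDiff_nuZ (hα : IsCocycle α) (hnorm : IsNormalized α) {x : G}
    (hx : x ∈ Subgroup.center G) {n : ℕ} (ψ : (Fin n → G) → k) :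
    hDiff α (Lmul α) (Rmul α) (nuZ α x ψ) = nuZ α x (cDiff (chi α x) ψ) := by
  refine ((isCentral_nuZ hα hnorm hx ψ).hDiff hα hnorm).ext hα hnorm
    (isCentral_nuZ hα hnorm hx _) fun z hz => ?_
  rw [piZ_hDiff_of_mem_center hα hnorm hz, piZ_nuZ hα hnorm, piZ_nuZ hα hnorm]
  split_ifs with h
  · rw [h]
  · exact cDiff_zero _

theorem hSigma_nuZ (hα : IsCocycle α) (hnorm : IsNormalized α) {x : G}
    (hx : x ∈ Subgroup.center G) {n : ℕ} (i : Fin n) (ψ : (Fin n → G) → k) :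
    hSigma α (Lmul α) (Rmul α) i (nuZ α x ψ) = nuZ α x (cSigma (chi α x) i ψ) := by
  refine ((isCentral_nuZ hα hnorm hx ψ).hSigma hα hnorm i).ext hα hnorm
    (isCentral_nuZ hα hnorm hx _) fun z hz => ?_
  rw [piZ_hSigma_of_mem_center hα hnorm hz, piZ_nuZ hα hnorm, piZ_nuZ hα hnorm]
  split_ifs with h
  · rw [h]
  · exact cSigma_zero _ i

theorem IsCSCoboundary.nuZ (hα : IsCocycle α) (hnorm : IsNormalized α) {x : G}
    (hx : x ∈ Subgroup.center G) {n : ℕ} {ψ : (Fin n → G) → k}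
    (h : IsCSCoboundary (chi α x) ψ) :
    IsHSCoboundary α (Lmul α) (Rmul α) (nuZ α x ψ) := by
  cases n with
  | zero =>
    obtain rfl : ψ = 0 := h
    funext g
    simp [TwistedSym.nuZ]
  | succ n =>
    obtain ⟨θ, hθ, rfl⟩ := h
    exact ⟨_, fun i => by rw [hSigma_nuZ hα hnorm hx, hθ], (hDiff_nuZ hα hnorm hx θ).symm⟩

variable [Fintype G] [DecidablePred fun g : G => g ∈ Subgroup.center G]

theorem piZ_sum_nuZ (hα : IsCocycle α) (hnorm : IsNormalized α) {n : ℕ}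
    (ψf : G → (Fin n → G) → k) (z : G) :
    piZ α z (∑ y ∈ Finset.univ.filter (fun g : G => g ∈ Subgroup.center G), nuZ α y (ψf y)) =
      if z ∈ Subgroup.center G then ψf z else 0 := by
  simp [piZ_sum hα hnorm, piZ_nuZ hα hnorm, Finset.sum_ite_eq]

theorem isCentral_sum_nuZ (hα : IsCocycle α) (hnorm : IsNormalized α) {n : ℕ}
    (ψf : G → (Fin n → G) → k) :
    IsCentral α
      (∑ y ∈ Finset.univ.filter (fun g : G => g ∈ Subgroup.center G), nuZ α y (ψf y)) := by
  intro z hz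
  rw [piZ_sum_nuZ hα hnorm, if_neg hz]

end Central

/-- for `x ∈ Z(G)`, `ν^n_{G,x,α}` maps `CS^n(G,k x̄)` into
`CS^n(k_αG,k_αG)` and induces `ν^{n,S}_{G,x,α} : HS^n(G,k x̄) → HHS^n(k_αG)`;
likewise `π^n_{G,x,α}` maps `CS^n(k_αG,k_αG)` into `CS^n(G,k x̄)` and induces
`π^{n,S}_{G,x,α} : HHS^n(k_αG) → HS^n(G,k x̄)`. Moreover `⊕_{x∈Z(G)} ν^{n,S}_{G,x,α}`
is injective with left inverse `⊕_{x∈Z(G)} π^{n,S}_{G,x,α}` (hence the latter is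
surjective). -/
theorem symmetric_embedding_twisted
    {k : Type*} [Field k] {G : Type*} [Group G] [Fintype G] [DecidableEq G]
    [DecidablePred fun g : G => g ∈ Subgroup.center G]
    (α : G → G → kˣ) (hα : IsCocycle α) (hnorm : IsNormalized α) {n : ℕ} :
    -- ν preserves symmetric cochains
    (∀ x ∈ Subgroup.center G, ∀ ψ : (Fin n → G) → k,
      (∀ i0 : Fin n, cSigma (chi α x) i0 ψ = ψ) →
      ∀ i0 : Fin n, hSigma α (Lmul α) (Rmul α) i0 (nuZ α x ψ) = nuZ α x ψ) ∧
    -- ν induces a well-defined map on symmetric cohomology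
    (∀ x ∈ Subgroup.center G,
      (∀ ψ : (Fin n → G) → k, (∀ i0 : Fin n, cSigma (chi α x) i0 ψ = ψ) →
        cDiff (chi α x) ψ = 0 → hDiff α (Lmul α) (Rmul α) (nuZ α x ψ) = 0) ∧
      (∀ ψ ψ' : (Fin n → G) → k,
        (∀ i0 : Fin n, cSigma (chi α x) i0 ψ = ψ) → cDiff (chi α x) ψ = 0 →
        (∀ i0 : Fin n, cSigma (chi α x) i0 ψ' = ψ') → cDiff (chi α x) ψ' = 0 →
        IsCSCoboundary (chi α x) (ψ - ψ') →
        IsHSCoboundary α (Lmul α) (Rmul α) (nuZ α x ψ - nuZ α x ψ'))) ∧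
    -- π preserves symmetric cochains
    (∀ x ∈ Subgroup.center G, ∀ φ : (Fin n → G) → (G → k),
      (∀ i0 : Fin n, hSigma α (Lmul α) (Rmul α) i0 φ = φ) →
      ∀ i0 : Fin n, cSigma (chi α x) i0 (piZ α x φ) = piZ α x φ) ∧
    -- π induces a well-defined map on symmetric cohomology
    (∀ x ∈ Subgroup.center G,
      (∀ φ : (Fin n → G) → (G → k),
        (∀ i0 : Fin n, hSigma α (Lmul α) (Rmul α) i0 φ = φ) →
        hDiff α (Lmul α) (Rmul α) φ = 0 → cDiff (chi α x) (piZ α x φ) = 0) ∧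
      (∀ φ φ' : (Fin n → G) → (G → k),
        (∀ i0 : Fin n, hSigma α (Lmul α) (Rmul α) i0 φ = φ) →
        hDiff α (Lmul α) (Rmul α) φ = 0 →
        (∀ i0 : Fin n, hSigma α (Lmul α) (Rmul α) i0 φ' = φ') →
        hDiff α (Lmul α) (Rmul α) φ' = 0 →
        IsHSCoboundary α (Lmul α) (Rmul α) (φ - φ') →
        IsCSCoboundary (chi α x) (piZ α x φ - piZ α x φ'))) ∧
    -- ⊕ ν^{n,S} is injective on symmetric cohomology
    (∀ ψf : G → (Fin n → G) → k,
      (∀ x ∈ Subgroup.center G,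
        (∀ i0 : Fin n, cSigma (chi α x) i0 (ψf x) = ψf x) ∧ cDiff (chi α x) (ψf x) = 0) →
      IsHSCoboundary α (Lmul α) (Rmul α)
        (∑ y ∈ Finset.univ.filter (fun g : G => g ∈ Subgroup.center G), nuZ α y (ψf y)) →
      ∀ x ∈ Subgroup.center G, IsCSCoboundary (chi α x) (ψf x)) ∧
    -- ⊕ π^{n,S} is a left inverse of ⊕ ν^{n,S} on symmetric cohomology
    (∀ ψf : G → (Fin n → G) → k,
      (∀ x ∈ Subgroup.center G,
        (∀ i0 : Fin n, cSigma (chi α x) i0 (ψf x) = ψf x) ∧ cDiff (chi α x) (ψf x) = 0) →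
      ∀ x ∈ Subgroup.center G,
        IsCSCoboundary (chi α x)
          (piZ α x (∑ y ∈ Finset.univ.filter (fun g : G => g ∈ Subgroup.center G),
            nuZ α y (ψf y)) - ψf x)) ∧
    -- ⊕ π^{n,S} is surjective on symmetric cohomology
    (∀ ψf : G → (Fin n → G) → k,
      (∀ x ∈ Subgroup.center G,
        (∀ i0 : Fin n, cSigma (chi α x) i0 (ψf x) = ψf x) ∧ cDiff (chi α x) (ψf x) = 0) →
      ∃ φ : (Fin n → G) → (G → k),
        (∀ i0 : Fin n, hSigma α (Lmul α) (Rmul α) i0 φ = φ) ∧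
        hDiff α (Lmul α) (Rmul α) φ = 0 ∧
        ∀ x ∈ Subgroup.center G, IsCSCoboundary (chi α x) (piZ α x φ - ψf x)) := by
  have hsum (ψf : G → (Fin n → G) → k) {x : G} (hx : x ∈ Subgroup.center G) :
      piZ α x (∑ y ∈ Finset.univ.filter (fun g : G => g ∈ Subgroup.center G), nuZ α y (ψf y)) =
        ψf x := by
    rw [piZ_sum_nuZ hα hnorm, if_pos hx]
  have hzero {m : ℕ} : IsCentral α (0 : (Fin m → G) → (G → k)) :=
    fun z _ => piZ_zero hα hnorm z
  refine ⟨fun x hx ψ hψ i => ?_, fun x hx => ⟨fun ψ _ hψ => ?_, fun ψ ψ' _ _ _ _ h => ?_⟩,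
    fun x hx φ hφ i => ?_, fun x hx => ⟨fun φ _ hφ => ?_, fun φ φ' _ _ _ _ h => ?_⟩,
    fun ψf _ h x hx => ?_, fun ψf _ x hx => ?_, fun ψf hψ => ⟨∑ y ∈ Finset.univ.filter
      (fun g : G => g ∈ Subgroup.center G), nuZ α y (ψf y), fun i => ?_, ?_, fun x hx => ?_⟩⟩
  · rw [hSigma_nuZ hα hnorm hx, hψ]
  · rw [hDiff_nuZ hα hnorm hx, hψ]
    funext g
    simp [nuZ]
  · have e : nuZ α x ψ - nuZ α x ψ' = nuZ α x (ψ - ψ') := by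
      funext g
      simp [nuZ, sub_smul]
    rw [e]
    exact h.nuZ hα hnorm hx
  · rw [← piZ_hSigma_of_mem_center hα hnorm hx, hφ]
  · rw [← piZ_hDiff_of_mem_center hα hnorm hx, hφ, piZ_zero hα hnorm]
  · rw [← piZ_sub hα hnorm]
    exact h.piZ hα hnorm hx
  · rw [← hsum ψf hx]
    exact h.piZ hα hnorm hx
  · rw [hsum ψf hx, sub_self]
    exact isCSCoboundary_zero _
  · refine ((isCentral_sum_nuZ hα hnorm ψf).hSigma hα hnorm i).ext hα hnorm
      (isCentral_sum_nuZ hα hnorm ψf) fun x hx => ?_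
    rw [piZ_hSigma_of_mem_center hα hnorm hx, hsum ψf hx, (hψ x hx).1]
  · refine ((isCentral_sum_nuZ hα hnorm ψf).hDiff hα hnorm).ext hα hnorm hzero fun x hx => ?_
    rw [piZ_hDiff_of_mem_center hα hnorm hx, hsum ψf hx, (hψ x hx).2, piZ_zero hα hnorm]
  · rw [hsum ψf hx, sub_self]
    exact isCSCoboundary_zero _

end TwistedSym
end

section
/- Let n ≥ 0 and suppose the short exact sequence 0 → A →^ι B →^π C → 0 of H-modules admits a symmetric section s_π compatible with the actions. Then for every φ ∈ CS^n(H,C) with ∂_C^n(φ) = 0, the cochain β_H^n(φ) = r_ι ∘ ∂_B^n(s_π ∘ φ) lies in CS^{n+1}(H,A), and the assignment [φ] ↦ [β_H^n(φ)] is a well-defined group homomorphism β_H^{n,S} : HS^n(H,C) → HS^{n+1}(H,A) (a connecting homomorphism in symmetric cohomology). -/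
/- Common setup: twisted group algebras modelled on their canonical basis.
An element of the twisted group algebra `k_αG` is modelled as a function `G → k`
(its coordinates in the basis `{ḡ : g ∈ G}`), and a Hochschild `n`-cochain
`Hom_k((k_αG)^{⊗n}, M)` is modelled by its values on basis tensors, i.e. as a
function `(Fin n → G) → M`.  Similarly a group cochain `C^n(H, A)` is a function
`(Fin n → H) → A`; the one-dimensional module `k x̄` is modelled as `k` with the
action of `h` given by multiplication by the character `χ(h) = α(h,x)·α(x,h)⁻¹`. -/

namespace TwistedSym

/-- The homogeneous cochain `(x₀,…,xₙ) ↦ x₀ · ψ(x₀⁻¹x₁,…,xₙ₋₁⁻¹xₙ)` of an inhomogeneous cochain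
`ψ`. -/
def homogenize {H A : Type*} [Group H] [AddCommGroup A] [DistribMulAction H A] {n : ℕ}
    (ψ : (Fin n → H) → A) (x : Fin (n + 1) → H) : A :=
  x 0 • ψ fun i => (x i.castSucc)⁻¹ * x i.succ

/-- The alternating face sum on functions of homogeneous tuples. -/
def faceSum {X A : Type*} [AddCommGroup A] {n : ℕ} (F : (Fin n → X) → A)
    (x : Fin (n + 1) → X) : A :=
  ∑ j : Fin (n + 1), ((-1 : ℤ) ^ (j : ℕ)) • F (j.removeNth x)

theorem faceSum_faceSum {X A : Type*} [AddCommGroup A] {n : ℕ} (F : (Fin n → X) → A) :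
    faceSum (faceSum F) = 0 := by
  funext x
  simp only [faceSum, Finset.smul_sum, smul_smul, ← pow_add, Pi.zero_apply]
  rw [← Fintype.sum_prod_type']
  refine Finset.sum_ninvolution (fun p => (p.1.succAbove p.2, p.2.predAbove p.1)) ?_ ?_ ?_ ?_
  · rintro ⟨i, j⟩
    dsimp only
    rw [← Fin.removeNth_removeNth_eq_swap, Fin.neg_one_pow_succAbove_add_predAbove, neg_smul,
      add_neg_cancel]
  · rintro ⟨i, j⟩ - h
    exact i.succAbove_ne j (congrArg Prod.fst h)
  · simp
  · rintro ⟨i, j⟩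
    simp [Fin.succAbove_succAbove_predAbove, Fin.predAbove_predAbove_succAbove]

theorem swap_comp_succAbove_swap {n : ℕ} (i : Fin (n + 1)) (j : Fin (n + 2)) :
    (j = i.castSucc ∨ j = i.succ) ∧
        (∀ l, Equiv.swap i.castSucc i.succ
          ((Equiv.swap i.castSucc i.succ j).succAbove l) = j.succAbove l) ∨
      (Equiv.swap i.castSucc i.succ j = j ∧ ∃ i' : Fin n, ∀ l,
        Equiv.swap i.castSucc i.succ (j.succAbove l) =
          j.succAbove (Equiv.swap i'.castSucc i'.succ l)) := by
  simp only [Fin.ext_iff, Equiv.swap_apply_def, Fin.succAbove, Fin.lt_def]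
  rcases lt_trichotomy (j : ℕ) i with h | h | h
  · right
    refine ⟨?_, ⟨i - 1, by omega⟩, fun l => ?_⟩
    · grind
    · grind
  · left
    grind
  · rcases eq_or_ne (j : ℕ) (i + 1) with h' | h'
    · left
      grind
    · right
      refine ⟨?_, ⟨i, by omega⟩, fun l => ?_⟩
      · grind
      · grind

theorem faceSum_comp_swap {X A : Type*} [AddCommGroup A] {n : ℕ} {F : (Fin (n + 1) → X) → A}
    (hF : ∀ (i : Fin n) x, F (x ∘ Equiv.swap i.castSucc i.succ) = -F x)
    (i : Fin (n + 1)) (x : Fin (n + 2) → X) :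
    faceSum F (x ∘ Equiv.swap i.castSucc i.succ) = -faceSum F x := by
  simp only [faceSum]
  rw [← Equiv.sum_comp (Equiv.swap i.castSucc i.succ), ← Finset.sum_neg_distrib]
  refine Finset.sum_congr rfl fun j _ => ?_
  rcases swap_comp_succAbove_swap i j with ⟨hj, h⟩ | ⟨hj, i', h⟩
  · have hx : (Equiv.swap i.castSucc i.succ j).removeNth (x ∘ Equiv.swap i.castSucc i.succ) =
        j.removeNth x := funext fun l => congrArg x (h l)
    rw [hx]
    rcases hj with rfl | rfl <;> simp [pow_succ]
  · have hx : j.removeNth (x ∘ Equiv.swap i.castSucc i.succ) =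
        j.removeNth x ∘ Equiv.swap i'.castSucc i'.succ := funext fun l => congrArg x (h l)
    rw [hj, hx, hF, smul_neg]

section Cochains

variable {H A B : Type*} [Group H] [AddCommGroup A] [DistribMulAction H A]
  [AddCommGroup B] [DistribMulAction H B] {n : ℕ}

theorem homogenize_partialProd (ψ : (Fin n → H) → A) (h : Fin n → H) :
    homogenize ψ (Fin.partialProd h) = ψ h := by
  simp [homogenize, Fin.partialProd_right_inv]

theorem homogenize_injective :
    Function.Injective (homogenize : ((Fin n → H) → A) → (Fin (n + 1) → H) → A) :=
  fun ψ ψ' e => funext fun h => by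
    rw [← homogenize_partialProd ψ, e, homogenize_partialProd]

theorem homogenize_gDiff (ψ : (Fin n → H) → A) :
    homogenize (gDiff ψ) = faceSum (homogenize ψ) := by
  funext x
  have hmerge : ∀ j : Fin n,
      mergeAt (fun i : Fin (n + 1) => (x i.castSucc)⁻¹ * x i.succ) j = fun i : Fin n =>
        (j.castSucc.succ.removeNth x i.castSucc)⁻¹ * j.castSucc.succ.removeNth x i.succ := by
    intro j
    funext l
    rcases lt_trichotomy l j with h | rfl | h
    · have h' : (l : ℕ) < j := h
      simp [mergeAt, Fin.removeNth, Fin.succAbove, Fin.lt_def, h', h'.le]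
    · simp [mergeAt, Fin.removeNth, Fin.succAbove, Fin.lt_def, mul_assoc]
    · have h' : (j : ℕ) < l := h
      simp [mergeAt, Fin.removeNth, Fin.succAbove, Fin.lt_def, h'.not_gt, h'.not_ge, h.ne']
  rw [faceSum, Fin.sum_univ_succ, Fin.sum_univ_castSucc]
  simp only [homogenize, gDiff, smul_add, Finset.smul_sum, hmerge]
  rw [add_assoc]
  refine congrArg₂ (· + ·) ?_ (congrArg₂ (· + ·) (Finset.sum_congr rfl fun j _ => ?_) ?_)
  · simp [Fin.removeNth, smul_smul]
  · rw [smul_comm]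
    simp [Fin.removeNth]
  · rw [smul_comm]
    simp [Fin.removeNth]

theorem homogenize_gSigma (i : Fin n) (ψ : (Fin n → H) → A) (x : Fin (n + 1) → H) :
    homogenize (gSigma i ψ) x = -homogenize ψ (x ∘ Equiv.swap i.castSucc i.succ) := by
  have hswap : swapTuple i (fun i : Fin n => (x i.castSucc)⁻¹ * x i.succ) = fun l : Fin n =>
      ((x ∘ Equiv.swap i.castSucc i.succ) l.castSucc)⁻¹ *
        (x ∘ Equiv.swap i.castSucc i.succ) l.succ := by
    funext l
    simp only [swapTuple, Function.comp_apply]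
    split_ifs with h₁ h₂ h₃
    · have e : i.castSucc = l.succ := Fin.ext h₁.symm
      rw [e, Equiv.swap_apply_left, ← e, Equiv.swap_apply_of_ne_of_ne]
      · group
      · simp [Fin.ext_iff]; omega
      · simp [Fin.ext_iff]; omega
    · subst h₂
      simp
    · have e : i.succ = l.castSucc := Fin.ext h₃.symm
      rw [← e, Equiv.swap_apply_right, Equiv.swap_apply_of_ne_of_ne]
      · group
      · simp [Fin.ext_iff]; omega
      · simp [Fin.ext_iff]; omega
    · rw [Fin.ext_iff] at h₂
      rw [Equiv.swap_apply_of_ne_of_ne, Equiv.swap_apply_of_ne_of_ne] <;>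
        simp [Fin.ext_iff] <;> omega
  simp only [homogenize, gSigma, hswap, smul_neg]
  split_ifs with h
  · have e : i.castSucc = 0 := Fin.ext h
    simp [e, smul_smul]
  · have e : Equiv.swap i.castSucc i.succ 0 = 0 :=
      Equiv.swap_apply_of_ne_of_ne (fun e => h (congrArg Fin.val e).symm) (Fin.succ_ne_zero i).symm
    simp [e]

theorem gSigma_eq_self_iff (ψ : (Fin n → H) → A) (i : Fin n) :
    gSigma i ψ = ψ ↔ ∀ x, homogenize ψ (x ∘ Equiv.swap i.castSucc i.succ) = -homogenize ψ x := by
  rw [← homogenize_injective.eq_iff, funext_iff]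
  simp only [homogenize_gSigma, neg_eq_iff_eq_neg]

/-- The symmetric cochains form a subcomplex. -/
theorem gSigma_gDiff {ψ : (Fin n → H) → A} (hψ : ∀ i, gSigma i ψ = ψ) (i : Fin (n + 1)) :
    gSigma i (gDiff ψ) = gDiff ψ := by
  rw [gSigma_eq_self_iff, homogenize_gDiff]
  exact faceSum_comp_swap (fun i => (gSigma_eq_self_iff ψ i).1 (hψ i)) i

theorem gDiff_gDiff (ψ : (Fin n → H) → A) : gDiff (gDiff ψ) = 0 := by
  apply homogenize_injective
  rw [homogenize_gDiff, homogenize_gDiff, faceSum_faceSum]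
  funext x
  simp [homogenize]

theorem gDiff_comp (f : A →+ B) (hf : ∀ (h : H) a, f (h • a) = h • f a) (ψ : (Fin n → H) → A)
    (h : Fin (n + 1) → H) : gDiff (fun h => f (ψ h)) h = f (gDiff ψ h) := by
  simp [gDiff, hf]

theorem gSigma_comp {f : A → B} (hneg : ∀ a, f (-a) = -f a)
    (hf : ∀ (h : H) a, f (h • a) = h • f a) (i : Fin n) (ψ : (Fin n → H) → A) (h : Fin n → H) :
    gSigma i (fun h => f (ψ h)) h = f (gSigma i ψ h) := by
  unfold gSigma
  split_ifs <;> simp [hneg, hf]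

theorem gDiff_sub (ψ ψ' : (Fin n → H) → A) : gDiff (ψ - ψ') = gDiff ψ - gDiff ψ' := by
  funext h
  simp only [gDiff, Pi.sub_apply, smul_sub, Finset.sum_sub_distrib]
  abel

theorem gSigma_sub (i : Fin n) (ψ ψ' : (Fin n → H) → A) :
    gSigma i (ψ - ψ') = gSigma i ψ - gSigma i ψ' := by
  funext h
  simp only [gSigma, Pi.sub_apply]
  split_ifs
  · rw [smul_sub]; abel
  · abel

theorem gSigma_add (i : Fin n) (ψ ψ' : (Fin n → H) → A) :
    gSigma i (ψ + ψ') = gSigma i ψ + gSigma i ψ' := by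
  funext h
  simp only [gSigma, Pi.add_apply]
  split_ifs
  · rw [smul_add]; abel
  · abel

end Cochains

/-- if the short exact sequence `0 → A →ι B →π C → 0` of `H`-modules
admits a symmetric section `s` compatible with the actions, then for every
symmetric `n`-cocycle `φ` with values in `C` the cochain
`β(φ) = r ∘ ∂_B^n(s ∘ φ)` lies in `CS^{n+1}(H,A)`, is a cocycle, and
`[φ] ↦ [β(φ)]` is a well-defined group homomorphism
`β_H^{n,S} : HS^n(H,C) → HS^{n+1}(H,A)` (a connecting homomorphism in symmetric
cohomology). -/
theorem connecting_hom_symmetric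
    {H : Type*} [Group H] {A B C : Type*}
    [AddCommGroup A] [AddCommGroup B] [AddCommGroup C]
    [DistribMulAction H A] [DistribMulAction H B] [DistribMulAction H C]
    (ι : A → B) (π : B → C)
    (hιadd : ∀ a a', ι (a + a') = ι a + ι a') (hιact : ∀ (h : H) (a : A), ι (h • a) = h • ι a)
    (hπadd : ∀ b b', π (b + b') = π b + π b') (hπact : ∀ (h : H) (b : B), π (h • b) = h • π b)
    (hιinj : Function.Injective ι) (hπsurj : Function.Surjective π)
    (hexact : ∀ b : B, π b = 0 ↔ ∃ a : A, ι a = b)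
    (s : C → B) (hs : ∀ c, π (s c) = c)
    (hssym : ∀ c, s (-c) = -s c) (hsact : ∀ (h : H) (c : C), s (h • c) = h • s c)
    (r : B → A) (hr1 : ∀ a, r (ι a) = a) (hr2 : ∀ b, π b = 0 → ι (r b) = b)
    {n : ℕ} (φ : (Fin n → H) → C)
    (hφsym : ∀ i0 : Fin n, gSigma i0 φ = φ) (hφ : gDiff φ = 0) :
    (∀ i0 : Fin (n + 1),
      gSigma i0 (fun h => r (gDiff (fun h' => s (φ h')) h)) =
        fun h => r (gDiff (fun h' => s (φ h')) h)) ∧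
    (gDiff (fun h => r (gDiff (fun h' => s (φ h')) h)) = 0) ∧
    (∀ φ' : (Fin n → H) → C, (∀ i0 : Fin n, gSigma i0 φ' = φ') → gDiff φ' = 0 →
      IsGSCoboundary (φ - φ') →
      IsGSCoboundary ((fun h => r (gDiff (fun h' => s (φ h')) h)) -
        fun h => r (gDiff (fun h' => s (φ' h')) h)) ) ∧
    (∀ φ' : (Fin n → H) → C, (∀ i0 : Fin n, gSigma i0 φ' = φ') → gDiff φ' = 0 →
      IsGSCoboundary ((fun h => r (gDiff (fun h' => s (φ h' + φ' h')) h)) -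
        (fun h => r (gDiff (fun h' => s (φ h')) h)) -
        fun h => r (gDiff (fun h' => s (φ' h')) h)) ) := by
  let ι' : A →+ B := AddMonoidHom.mk' ι hιadd
  let π' : B →+ C := AddMonoidHom.mk' π hπadd
  have hsσ : ∀ ψ : (Fin n → H) → C, (∀ i, gSigma i ψ = ψ) →
      ∀ i, gSigma i (fun h => s (ψ h)) = fun h => s (ψ h) := fun ψ hψ i => by
    funext h
    rw [gSigma_comp hssym hsact, hψ]
  have hker : ∀ ψ : (Fin n → H) → C, gDiff ψ = 0 →
      (fun h => ι (r (gDiff (fun h' => s (ψ h')) h))) = gDiff fun h' => s (ψ h') := by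
    intro ψ hψ
    funext h
    apply hr2
    have := gDiff_comp π' hπact (fun h' => s (ψ h')) h
    simp only [π', AddMonoidHom.mk'_apply, hs] at this
    rw [← this]
    exact congrFun hψ h
  have lift_symm : ∀ {m : ℕ} (θ : (Fin m → H) → A),
      (∀ i, gSigma i (fun h => ι (θ h)) = fun h => ι (θ h)) → ∀ i, gSigma i θ = θ := by
    intro m θ hθ i
    funext h
    apply hιinj
    rw [← gSigma_comp (f := ι) ι'.map_neg hιact]
    exact congrFun (hθ i) h
  have lift_diff : ∀ {m : ℕ} (θ : (Fin m → H) → A) (ξ : (Fin (m + 1) → H) → A),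
      (fun h => ι (ξ h)) = gDiff (fun h => ι (θ h)) → ξ = gDiff θ := by
    intro m θ ξ e
    funext h
    apply hιinj
    exact (congrFun e h).trans (gDiff_comp ι' hιact θ h)
  have lift_coboundary : ∀ (f : (Fin n → H) → B) (ξ : (Fin (n + 1) → H) → A),
      (∀ h, π (f h) = 0) → (∀ i, gSigma i f = f) → (fun h => ι (ξ h)) = gDiff f →
      IsGSCoboundary ξ := by
    intro f ξ hf hσ e
    have hrf : (fun h => ι (r (f h))) = f := funext fun h => hr2 _ (hf h)
    refine ⟨fun h => r (f h), lift_symm _ ?_, lift_diff _ _ ?_⟩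
    · rwa [hrf]
    · rwa [hrf]
  have hπs : ∀ ψ : (Fin n → H) → C, ∀ h, π' (s (ψ h)) = ψ h := fun ψ h => hs _
  refine ⟨lift_symm _ ?_, ?_, ?_, ?_⟩
  · rw [hker φ hφ]
    exact gSigma_gDiff (hsσ φ hφsym)
  · refine (lift_diff _ 0 ?_).symm
    rw [hker φ hφ, gDiff_gDiff]
    exact funext fun _ => ι'.map_zero
  · intro φ' hφ'sym hφ' hcob
    have hξ : ∀ f : (Fin n → H) → B, gDiff f = 0 →
        (fun h => ι (r (gDiff (fun h' => s (φ h')) h) - r (gDiff (fun h' => s (φ' h')) h))) =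
          gDiff ((fun h => s (φ h)) - (fun h => s (φ' h)) - f) := by
      intro f hf
      rw [gDiff_sub, gDiff_sub, hf, sub_zero]
      exact funext fun h => (ι'.map_sub _ _).trans
        (congrArg₂ (· - ·) (congrFun (hker φ hφ) h) (congrFun (hker φ' hφ') h))
    obtain ⟨f, hfσ, hfd, hfπ⟩ : ∃ f : (Fin n → H) → B, (∀ i, gSigma i f = f) ∧ gDiff f = 0 ∧
        ∀ h, π' (f h) = φ h - φ' h := by
      cases n with
      | zero =>
        refine ⟨0, fun i => i.elim0, ?_, fun h => ?_⟩
        · funext h; simp [gDiff]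
        · simpa using (congrFun hcob h).symm
      | succ m =>
        obtain ⟨θ, hθ, e⟩ := hcob
        refine ⟨gDiff fun h => s (θ h), gSigma_gDiff fun i => ?_, gDiff_gDiff _, fun h => ?_⟩
        · funext h
          rw [gSigma_comp hssym hsact, hθ]
        · rw [← gDiff_comp π' hπact]
          simp only [π', AddMonoidHom.mk'_apply, hs]
          exact (congrFun e h).symm
    refine lift_coboundary _ _ (fun h => ?_) (fun i => ?_) (hξ f hfd)
    · change π' (s (φ h) - s (φ' h) - f h) = 0
      rw [map_sub, map_sub, hπs, hπs, hfπ, sub_self]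
    · rw [gSigma_sub, gSigma_sub, hsσ φ hφsym, hsσ φ' hφ'sym, hfσ]
  · intro φ' hφ'sym hφ'
    have hsum : gDiff (fun h => φ h + φ' h) = 0 := by
      have := gDiff_sub (fun h => φ h + φ' h) φ'
      rw [hφ', sub_zero] at this
      rw [← this, ← hφ]
      congr 1
      funext h
      simp
    have hsumσ : ∀ i, gSigma i (fun h => φ h + φ' h) = fun h => φ h + φ' h := fun i => by
      have := gSigma_add i φ φ'
      rwa [hφsym, hφ'sym] at this
    refine lift_coboundary
      ((fun h => s (φ h + φ' h)) - (fun h => s (φ h)) - (fun h => s (φ' h))) _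
      (fun h => ?_) (fun i => ?_) ?_
    · change π' (s (φ h + φ' h) - s (φ h) - s (φ' h)) = 0
      rw [map_sub, map_sub, hπs, hπs, hπs (fun h => φ h + φ' h)]
      abel
    · rw [gSigma_sub, gSigma_sub, hsσ φ hφsym, hsσ φ' hφ'sym, hsσ _ hsumσ]
    · rw [gDiff_sub, gDiff_sub]
      exact funext fun h => (ι'.map_sub _ _).trans (congrArg₂ (· - ·)
        ((ι'.map_sub _ _).trans
          (congrArg₂ (· - ·) (congrFun (hker _ hsum) h) (congrFun (hker φ hφ) h)))
        (congrFun (hker φ' hφ') h))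

end TwistedSym
end
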